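/- arXiv:2411.09352 — 2 statements merged into one kernel-verified Lean document; each statement's English description precedes it below -/
import Mathlib

section
/- Assume ρ is C¹ with ρ(p,S) > 0 and ρ_p(p,S) > 0 for all (p,S), and set Â_j(U) = A₀(U)⁻¹A_j(U). Let t ↦ U′(t) be a differentiable curve in ℝ⁸ with U′(t) ∈ N for all t. Then for j = 1,2 the derivative matrix (d/dt)Â_j(U′(t)) maps N into N and N^⊥ into N^⊥, while (d/dt)Â₃(U′(t)) maps N into N^⊥ and N^⊥ into N. -/
open Matrix

noncomputable section

/- The state vector is `U : Fin 8 → ℝ` with `p = U 0`, `u = (U 1, U 2, U 3)`,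
`H = (U 4, U 5, U 6)`, `S = U 7`.  The state equation `ρ = ρ(p,S)` and its
partial derivative `ρ_p = ∂ρ/∂p` are given as curried functions `ℝ → ℝ → ℝ`. -/

/-- `A₀(U) = blockdiag(ρ_p/ρ, ρ I₃, I₃, 1)`. -/
def A0mat (ρ ρp : ℝ → ℝ → ℝ) (U : Fin 8 → ℝ) : Matrix (Fin 8) (Fin 8) ℝ :=
  Matrix.diagonal fun i =>
    if (i : ℕ) = 0 then ρp (U 0) (U 7) / ρ (U 0) (U 7)
    else if (i : ℕ) ≤ 3 then ρ (U 0) (U 7)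
    else 1

/-- `A_j(U)`, `j : Fin 3` (so `j = 0,1,2` corresponds to `x₁,x₂,x₃`): the 8×8 matrix
with blocks (p,p)-entry `(ρ_p/ρ)u_j`; (p,u)-block the row vector `δ_j`; (u,p)-block `δ_jᵀ`;
(u,u)-block `ρ u_j I₃`; (u,H)-block `δ_j ⊗ H − H_j I₃` (where `(δ_j ⊗ H)_{k i} = δ_{j k} H_i`);
(H,u)-block `(δ_j ⊗ H)ᵀ − H_j I₃`; (H,H)-block `u_j I₃`; (S,S)-entry `u_j`; all other
entries zero. -/
def Amat (ρ ρp : ℝ → ℝ → ℝ) (j : Fin 3) (U : Fin 8 → ℝ) : Matrix (Fin 8) (Fin 8) ℝ :=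
  Matrix.of fun i k =>
    let a : ℕ := (i : ℕ)
    let b : ℕ := (k : ℕ)
    let uj : ℝ := U ⟨1 + (j : ℕ), by have := j.isLt; omega⟩
    let Hj : ℝ := U ⟨4 + (j : ℕ), by have := j.isLt; omega⟩
    if a = 0 ∧ b = 0 then ρp (U 0) (U 7) / ρ (U 0) (U 7) * uj
    else if a = 0 ∧ 1 ≤ b ∧ b ≤ 3 then (if b = 1 + (j : ℕ) then 1 else 0)
    else if 1 ≤ a ∧ a ≤ 3 ∧ b = 0 then (if a = 1 + (j : ℕ) then 1 else 0)
    else if 1 ≤ a ∧ a ≤ 3 ∧ 1 ≤ b ∧ b ≤ 3 then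
      (if a = b then ρ (U 0) (U 7) * uj else 0)
    else if 1 ≤ a ∧ a ≤ 3 ∧ 4 ≤ b ∧ b ≤ 6 then
      (if a = 1 + (j : ℕ) then U k else 0) - (if b = a + 3 then Hj else 0)
    else if 4 ≤ a ∧ a ≤ 6 ∧ 1 ≤ b ∧ b ≤ 3 then
      (if b = 1 + (j : ℕ) then U i else 0) - (if a = b + 3 then Hj else 0)
    else if 4 ≤ a ∧ a ≤ 6 ∧ 4 ≤ b ∧ b ≤ 6 then (if a = b then uj else 0)
    else if a = 7 ∧ b = 7 then uj
    else 0

/-- `N = {V ∈ ℝ⁸ : V₄ = V₇ = 0}` (0-indexed: components `3` and `6`, i.e. `u₃` and `H₃`). -/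
def Nset : Set (Fin 8 → ℝ) := {V | V 3 = 0 ∧ V 6 = 0}

/-- `N^⊥ = {V ∈ ℝ⁸ : V₁ = V₂ = V₃ = V₅ = V₆ = V₈ = 0}` (0-indexed components
`0,1,2,4,5,7`). -/
def Nperp : Set (Fin 8 → ℝ) :=
  {V | V 0 = 0 ∧ V 1 = 0 ∧ V 2 = 0 ∧ V 4 = 0 ∧ V 5 = 0 ∧ V 7 = 0}

/-- `Â_j(U) = A₀(U)⁻¹ A_j(U)`. -/
def Ahat (ρ ρp : ℝ → ℝ → ℝ) (j : Fin 3) (U : Fin 8 → ℝ) : Matrix (Fin 8) (Fin 8) ℝ :=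
  (A0mat ρ ρp U)⁻¹ * Amat ρ ρp j U

theorem Ahat_mulVec_eq_zero (ρ ρp : ℝ → ℝ → ℝ) (j : Fin 3) (U V : Fin 8 → ℝ) (i : Fin 8)
    (h : (Amat ρ ρp j U *ᵥ V) i = 0) : (Ahat ρ ρp j U *ᵥ V) i = 0 := by
  rw [Ahat, A0mat, inv_diagonal, ← mulVec_mulVec, mulVec_diagonal, h, mul_zero]

theorem Amat_mulVec_mem_Nset (ρ ρp : ℝ → ℝ → ℝ) {j : Fin 3} (hj : (j : ℕ) < 2)
    {U V : Fin 8 → ℝ} (hU : U ∈ Nset) (hV : V ∈ Nset) : Amat ρ ρp j U *ᵥ V ∈ Nset := by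
  obtain ⟨-, hU6⟩ := hU
  obtain ⟨hV3, hV6⟩ := hV
  obtain rfl | rfl : j = 0 ∨ j = 1 := by omega
  all_goals refine ⟨?_, ?_⟩ <;>
    simp [Amat, mulVec, dotProduct, Fin.sum_univ_eight,
      hU6, hV3, hV6]

theorem Amat_mulVec_mem_Nperp (ρ ρp : ℝ → ℝ → ℝ) {j : Fin 3} (hj : (j : ℕ) < 2)
    {U V : Fin 8 → ℝ} (hU : U ∈ Nset) (hV : V ∈ Nperp) : Amat ρ ρp j U *ᵥ V ∈ Nperp := by
  obtain ⟨-, hU6⟩ := hU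
  obtain ⟨hV0, hV1, hV2, hV4, hV5, hV7⟩ := hV
  obtain rfl | rfl : j = 0 ∨ j = 1 := by omega
  all_goals refine ⟨?_, ?_, ?_, ?_, ?_, ?_⟩ <;>
    simp [Amat, mulVec, dotProduct, Fin.sum_univ_eight,
      hU6, hV0, hV1, hV2, hV4, hV5, hV7]

theorem Amat_two_mulVec_mem_Nperp (ρ ρp : ℝ → ℝ → ℝ)
    {U V : Fin 8 → ℝ} (hU : U ∈ Nset) (hV : V ∈ Nset) : Amat ρ ρp 2 U *ᵥ V ∈ Nperp := by
  obtain ⟨hU3, hU6⟩ := hU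
  obtain ⟨hV3, -⟩ := hV
  refine ⟨?_, ?_, ?_, ?_, ?_, ?_⟩ <;>
    simp [Amat, mulVec, dotProduct, Fin.sum_univ_eight,
      hU3, hU6, hV3]

theorem Amat_two_mulVec_mem_Nset (ρ ρp : ℝ → ℝ → ℝ)
    {U V : Fin 8 → ℝ} (hU : U ∈ Nset) (hV : V ∈ Nperp) : Amat ρ ρp 2 U *ᵥ V ∈ Nset := by
  obtain ⟨hU3, hU6⟩ := hU
  obtain ⟨hV0, -, -, hV4, hV5, -⟩ := hV
  refine ⟨?_, ?_⟩ <;>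
    simp [Amat, mulVec, dotProduct, Fin.sum_univ_eight,
      hU3, hU6, hV0, hV4, hV5]

theorem deriv_Ahat_mulVec_eq_zero (ρ ρp : ℝ → ℝ → ℝ) (j : Fin 3) (U : ℝ → Fin 8 → ℝ)
    (V : Fin 8 → ℝ) (i : Fin 8) (h : ∀ s, (Amat ρ ρp j (U s) *ᵥ V) i = 0) (t : ℝ) :
    deriv (fun s => (Ahat ρ ρp j (U s) *ᵥ V) i) t = 0 := by
  simp [fun s => Ahat_mulVec_eq_zero ρ ρp j (U s) V i (h s)]

theorem deriv_Ahat_mulVec_mem_Nset (ρ ρp : ℝ → ℝ → ℝ) (j : Fin 3) (U : ℝ → Fin 8 → ℝ)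
    (V : Fin 8 → ℝ) (h : ∀ s, Amat ρ ρp j (U s) *ᵥ V ∈ Nset) (t : ℝ) :
    (fun i => deriv (fun s => (Ahat ρ ρp j (U s) *ᵥ V) i) t) ∈ Nset :=
  ⟨deriv_Ahat_mulVec_eq_zero ρ ρp j U V 3 (fun s => (h s).1) t,
    deriv_Ahat_mulVec_eq_zero ρ ρp j U V 6 (fun s => (h s).2) t⟩

theorem deriv_Ahat_mulVec_mem_Nperp (ρ ρp : ℝ → ℝ → ℝ) (j : Fin 3) (U : ℝ → Fin 8 → ℝ)
    (V : Fin 8 → ℝ) (h : ∀ s, Amat ρ ρp j (U s) *ᵥ V ∈ Nperp) (t : ℝ) :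
    (fun i => deriv (fun s => (Ahat ρ ρp j (U s) *ᵥ V) i) t) ∈ Nperp :=
  ⟨deriv_Ahat_mulVec_eq_zero ρ ρp j U V 0 (fun s => (h s).1) t,
    deriv_Ahat_mulVec_eq_zero ρ ρp j U V 1 (fun s => (h s).2.1) t,
    deriv_Ahat_mulVec_eq_zero ρ ρp j U V 2 (fun s => (h s).2.2.1) t,
    deriv_Ahat_mulVec_eq_zero ρ ρp j U V 4 (fun s => (h s).2.2.2.1) t,
    deriv_Ahat_mulVec_eq_zero ρ ρp j U V 5 (fun s => (h s).2.2.2.2.1) t,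
    deriv_Ahat_mulVec_eq_zero ρ ρp j U V 7 (fun s => (h s).2.2.2.2.2) t⟩

/-- if `ρ` is `C¹` with `ρ > 0`, `ρ_p = ∂ρ/∂p > 0`, and `t ↦ U′(t)` is a
differentiable curve with values in `N`, then `(d/dt)Â_j(U′(t))` maps `N → N` and
`N^⊥ → N^⊥` for `j = 1,2`, while `(d/dt)Â₃(U′(t))` maps `N → N^⊥` and `N^⊥ → N`.
(The derivative of the matrix applied to a constant vector `V` is the derivative of
`t ↦ Â_j(U′(t)) V`, computed componentwise.) -/
theorem statement3 (ρ ρp : ℝ → ℝ → ℝ)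
    (hρC1 : ContDiff ℝ 1 (fun q : ℝ × ℝ => ρ q.1 q.2))
    (hρp_def : ∀ p S, ρp p S = deriv (fun p' => ρ p' S) p)
    (hρ : ∀ p S, 0 < ρ p S) (hρp : ∀ p S, 0 < ρp p S)
    (U' : ℝ → Fin 8 → ℝ) (hU'diff : Differentiable ℝ U')
    (hU'N : ∀ t, U' t ∈ Nset) :
    ∀ t : ℝ,
      (∀ j : Fin 3, (j : ℕ) < 2 →
        (∀ V ∈ Nset,
          (fun i => deriv (fun s => (Ahat ρ ρp j (U' s)).mulVec V i) t) ∈ Nset) ∧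
        (∀ V ∈ Nperp,
          (fun i => deriv (fun s => (Ahat ρ ρp j (U' s)).mulVec V i) t) ∈ Nperp)) ∧
      (∀ V ∈ Nset,
        (fun i => deriv (fun s => (Ahat ρ ρp 2 (U' s)).mulVec V i) t) ∈ Nperp) ∧
      (∀ V ∈ Nperp,
        (fun i => deriv (fun s => (Ahat ρ ρp 2 (U' s)).mulVec V i) t) ∈ Nset) := by
  intro t
  refine ⟨fun j hj => ⟨fun V hV => ?_, fun V hV => ?_⟩, fun V hV => ?_, fun V hV => ?_⟩
  · exact deriv_Ahat_mulVec_mem_Nset ρ ρp j U' V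
      (fun s => Amat_mulVec_mem_Nset ρ ρp hj (hU'N s) hV) t
  · exact deriv_Ahat_mulVec_mem_Nperp ρ ρp j U' V
      (fun s => Amat_mulVec_mem_Nperp ρ ρp hj (hU'N s) hV) t
  · exact deriv_Ahat_mulVec_mem_Nperp ρ ρp 2 U' V
      (fun s => Amat_two_mulVec_mem_Nperp ρ ρp (hU'N s) hV) t
  · exact deriv_Ahat_mulVec_mem_Nset ρ ρp 2 U' V
      (fun s => Amat_two_mulVec_mem_Nset ρ ρp (hU'N s) hV) t
end
end

section
/- Let R = diag(1,1,1,−1,1,1,−1,1) and r(x₁,x₂,x₃) = (x₁,x₂,−x₃). Let O ⊆ ℝ × ℝ³ be open and let U : O → ℝ⁸ be differentiable and satisfy the quasilinear MHD system A₀(U)∂_tU + Σ_{j=1}^{3} A_j(U)∂_jU = 0 on O. Then the reflected function Ũ(t,x) := R U(t, r(x)), defined on the reflected set O′ = {(t,x) : (t,r(x)) ∈ O}, is differentiable and satisfies the same system A₀(Ũ)∂_tŨ + Σ_{j=1}^{3} A_j(Ũ)∂_jŨ = 0 on O′. -/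
open Matrix

noncomputable section

/-- `R = diag(1,1,1,−1,1,1,−1,1)`. -/
def Rmat : Matrix (Fin 8) (Fin 8) ℝ :=
  Matrix.diagonal fun i => if (i : ℕ) = 3 ∨ (i : ℕ) = 6 then -1 else 1

/-- the spatial reflection `r(x₁,x₂,x₃) = (x₁,x₂,−x₃)`. -/
def rRefl (x : Fin 3 → ℝ) : Fin 3 → ℝ := fun j => if (j : ℕ) = 2 then -x j else x j

/-- The sign picked up by the `j`-th spatial direction under the reflection `rRefl`. -/
def reflSign (j : Fin 3) : ℝ := if (j : ℕ) = 2 then -1 else 1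

theorem reflSign_mul_self (j : Fin 3) : reflSign j * reflSign j = 1 := by
  fin_cases j <;> simp [reflSign]

theorem rRefl_single (j : Fin 3) : rRefl (Pi.single j 1) = reflSign j • Pi.single j 1 := by
  ext k
  fin_cases j <;> fin_cases k <;> simp [rRefl, reflSign]

/-- The space-time reflection `(t, x) ↦ (t, r(x))` as a continuous linear map. -/
def spaceTimeRefl : ℝ × (Fin 3 → ℝ) →L[ℝ] ℝ × (Fin 3 → ℝ) :=
  LinearMap.toContinuousLinearMap
    { toFun := fun w => (w.1, rRefl w.2)
      map_add' := fun v w => by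
        ext k
        · simp
        · simp only [rRefl, Prod.snd_add, Pi.add_apply]
          split_ifs <;> ring
      map_smul' := fun c w => by
        ext k
        · simp
        · simp [rRefl] }

theorem spaceTimeRefl_apply (w : ℝ × (Fin 3 → ℝ)) : spaceTimeRefl w = (w.1, rRefl w.2) := rfl

theorem spaceTimeRefl_time : spaceTimeRefl (1, 0) = (1, 0) := by
  ext k <;> simp [spaceTimeRefl_apply, rRefl]

theorem spaceTimeRefl_single (j : Fin 3) :
    spaceTimeRefl (0, Pi.single j 1) = reflSign j • (0, Pi.single j 1) := by
  simp [spaceTimeRefl_apply, rRefl_single]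

theorem Rmat_mulVec_apply (V : Fin 8 → ℝ) (i : Fin 8) :
    Rmat.mulVec V i = (if (i : ℕ) = 3 ∨ (i : ℕ) = 6 then -1 else 1) * V i :=
  Matrix.mulVec_diagonal _ _ _

theorem A0mat_reflect (ρ ρp : ℝ → ℝ → ℝ) (V : Fin 8 → ℝ) :
    A0mat ρ ρp (Rmat.mulVec V) * Rmat = Rmat * A0mat ρ ρp V := by
  have hA : A0mat ρ ρp (Rmat.mulVec V) = A0mat ρ ρp V := by
    simp [A0mat, Rmat_mulVec_apply]
  rw [hA]
  simp only [A0mat, Rmat, Matrix.diagonal_mul_diagonal, mul_comm]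

theorem Amat_reflect (ρ ρp : ℝ → ℝ → ℝ) (j : Fin 3) (V : Fin 8 → ℝ) :
    Amat ρ ρp j (Rmat.mulVec V) * Rmat = reflSign j • (Rmat * Amat ρ ρp j V) := by
  ext i k
  rw [Matrix.smul_apply, Rmat, Matrix.mul_diagonal, Matrix.diagonal_mul, ← Rmat]
  simp only [Amat, Matrix.of_apply, Rmat_mulVec_apply]
  fin_cases j <;> fin_cases i <;> fin_cases k <;> simp [reflSign]

theorem hasFDerivAt_reflect {U : ℝ × (Fin 3 → ℝ) → Fin 8 → ℝ} {z : ℝ × (Fin 3 → ℝ)}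
    (hU : DifferentiableAt ℝ U (z.1, rRefl z.2)) :
    HasFDerivAt (fun w : ℝ × (Fin 3 → ℝ) => Rmat.mulVec (U (w.1, rRefl w.2)))
      ((LinearMap.toContinuousLinearMap Rmat.mulVecLin).comp
        ((fderiv ℝ U (z.1, rRefl z.2)).comp spaceTimeRefl)) z :=
  (LinearMap.toContinuousLinearMap Rmat.mulVecLin).hasFDerivAt.comp z
    (HasFDerivAt.comp z (f := spaceTimeRefl) hU.hasFDerivAt spaceTimeRefl.hasFDerivAt)

theorem fderiv_reflect {U : ℝ × (Fin 3 → ℝ) → Fin 8 → ℝ} {z : ℝ × (Fin 3 → ℝ)}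
    (hU : DifferentiableAt ℝ U (z.1, rRefl z.2)) (v : ℝ × (Fin 3 → ℝ)) :
    fderiv ℝ (fun w : ℝ × (Fin 3 → ℝ) => Rmat.mulVec (U (w.1, rRefl w.2))) z v =
      Rmat.mulVec (fderiv ℝ U (z.1, rRefl z.2) (spaceTimeRefl v)) := by
  rw [(hasFDerivAt_reflect hU).fderiv]
  rfl

/-- if a differentiable `U : O → ℝ⁸` satisfies the quasilinear MHD system
`A₀(U)∂_tU + Σ_j A_j(U)∂_jU = 0` on an open set `O ⊆ ℝ × ℝ³`, then the reflected
function `Ũ(t,x) = R U(t, r(x))` is differentiable and satisfies the same system on the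
reflected set `O′ = {(t,x) : (t, r(x)) ∈ O}`.  Here `∂_t` and `∂_j` are the partial
derivatives `fderiv ℝ · (1,0)` and `fderiv ℝ · (0, Pi.single j 1)`. -/
theorem statement9 (ρ ρp : ℝ → ℝ → ℝ)
    (O : Set (ℝ × (Fin 3 → ℝ))) (hO : IsOpen O)
    (U : ℝ × (Fin 3 → ℝ) → Fin 8 → ℝ)
    (hdiff : ∀ z ∈ O, DifferentiableAt ℝ U z)
    (hPDE : ∀ z ∈ O,
      (A0mat ρ ρp (U z)).mulVec (fderiv ℝ U z (1, 0)) +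
        ∑ j : Fin 3,
          (Amat ρ ρp j (U z)).mulVec (fderiv ℝ U z (0, Pi.single j 1)) = 0) :
    (∀ z ∈ {w : ℝ × (Fin 3 → ℝ) | (w.1, rRefl w.2) ∈ O},
      DifferentiableAt ℝ (fun w => Rmat.mulVec (U (w.1, rRefl w.2))) z) ∧
    ∀ z ∈ {w : ℝ × (Fin 3 → ℝ) | (w.1, rRefl w.2) ∈ O},
      (A0mat ρ ρp ((fun w => Rmat.mulVec (U (w.1, rRefl w.2))) z)).mulVec
          (fderiv ℝ (fun w => Rmat.mulVec (U (w.1, rRefl w.2))) z (1, 0)) +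
        ∑ j : Fin 3,
          (Amat ρ ρp j ((fun w => Rmat.mulVec (U (w.1, rRefl w.2))) z)).mulVec
            (fderiv ℝ (fun w => Rmat.mulVec (U (w.1, rRefl w.2))) z
              (0, Pi.single j 1)) = 0 := by
  refine ⟨fun z hz => (hasFDerivAt_reflect (hdiff _ hz)).differentiableAt, fun z hz => ?_⟩
  have hU := hdiff _ hz
  have hspace (j : Fin 3) :
      (Amat ρ ρp j (Rmat.mulVec (U (z.1, rRefl z.2)))).mulVec
          (fderiv ℝ (fun w => Rmat.mulVec (U (w.1, rRefl w.2))) z (0, Pi.single j 1)) =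
        Rmat.mulVec ((Amat ρ ρp j (U (z.1, rRefl z.2))).mulVec
          (fderiv ℝ U (z.1, rRefl z.2) (0, Pi.single j 1))) := by
    rw [fderiv_reflect hU, spaceTimeRefl_single, map_smul, Matrix.mulVec_mulVec, Amat_reflect,
      Matrix.mulVec_smul, Matrix.smul_mulVec, smul_smul, reflSign_mul_self, one_smul,
      Matrix.mulVec_mulVec]
  simp only [hspace]
  rw [fderiv_reflect hU, spaceTimeRefl_time, Matrix.mulVec_mulVec, A0mat_reflect,
    ← Matrix.mulVec_mulVec, ← Matrix.mulVec_sum, ← Matrix.mulVec_add, hPDE _ hz,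
    Matrix.mulVec_zero]
end
end
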